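/- For every d ∈ ℕ there exist positive constants C1(d), C2(d), C3(d) with the following property: for every n ∈ ℕ there exists a finite set Y_s = {y_1,…,y_s} ⊂ 𝕋^d with s ≤ C1(d)·2^{nd} such that for all 1 ≤ p ≤ ∞ and all real trigonometric polynomials f with frequencies in the cube Π_n := [−2^n, 2^n]^d one has C2(d)·‖f‖_p ≤ ((1/s)·∑_{j=1}^s |f(y_j)|^p)^{1/p} ≤ C3(d)·‖f‖_p (with the max over the points in place of the discrete p-mean when p = ∞). -/

import Mathlib

noncomputable section
open MeasureTheory

/-- The fundamental cell `[0, 2π)^d` of the torus `𝕋^d`. -/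
def torusCell (d : ℕ) : Set (Fin d → ℝ) := Set.univ.pi fun _ => Set.Ico 0 (2 * Real.pi)

/-- Normalized Lebesgue (probability) measure on the torus `𝕋^d = [0,2π)^d`. -/
def torusMeasure (d : ℕ) : Measure (Fin d → ℝ) :=
  (ENNReal.ofReal ((2 * Real.pi) ^ d))⁻¹ • (volume.restrict (torusCell d))

/-- The `L_p` norm on the torus with respect to the normalized Lebesgue measure. -/
def torusLq (d : ℕ) (p : ℝ) {E : Type*} [NormedAddCommGroup E] (f : (Fin d → ℝ) → E) : ℝ :=
  (∫ x, ‖f x‖ ^ p ∂(torusMeasure d)) ^ (1 / p)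

/-- The uniform norm on the torus of a real-valued function. -/
def torusSup (d : ℕ) (f : (Fin d → ℝ) → ℝ) : ℝ := ⨆ x : torusCell d, |f x.1|

/-- `f` is a real trigonometric polynomial with frequencies in the cube `Π_n = [-2^n, 2^n]^d`. -/
def IsRealTrigPolyCube (d n : ℕ) (f : (Fin d → ℝ) → ℝ) : Prop :=
  ∃ c : (Fin d → ℤ) → ℂ,
    ∀ x, (f x : ℂ) = ∑ k ∈ Fintype.piFinset (fun _ : Fin d => Finset.Icc (-(2 ^ n) : ℤ) (2 ^ n)),
      c k * Complex.exp (Complex.I * ∑ j, (k j : ℂ) * (x j : ℂ))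

namespace MZ

def E {d : ℕ} (k : Fin d → ℤ) (x : Fin d → ℝ) : ℂ :=
  Complex.exp (Complex.I * ∑ j, (k j : ℂ) * (x j : ℂ))

def box (d : ℕ) (m : ℤ) : Finset (Fin d → ℤ) :=
  Fintype.piFinset (fun _ : Fin d => Finset.Icc (-m) m)

def S {d : ℕ} (T : Finset (Fin d → ℤ)) (z : Fin d → ℝ) : ℂ := ∑ a ∈ T, E a z

variable {d : ℕ}

lemma E_add (k l : Fin d → ℤ) (x : Fin d → ℝ) : E (k + l) x = E k x * E l x := by
  simp only [E, ← Complex.exp_add, ← mul_add, ← Finset.sum_add_distrib]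
  congr 2
  refine Finset.sum_congr rfl fun j _ => ?_
  simp; ring

lemma E_neg_swap (k : Fin d → ℤ) (x : Fin d → ℝ) : E k (-x) = E (-k) x := by
  simp [E]

lemma E_sub_arg (k : Fin d → ℤ) (x y : Fin d → ℝ) : E k (x - y) = E k x * E (-k) y := by
  simp only [E, ← Complex.exp_add, ← mul_add, ← Finset.sum_add_distrib]
  congr 2
  refine Finset.sum_congr rfl fun j _ => ?_
  simp; ring

lemma E_norm (k : Fin d → ℤ) (x : Fin d → ℝ) : ‖E k x‖ = 1 := by
  have : E k x = Complex.exp ((∑ j, (k j : ℝ) * x j : ℝ) * Complex.I) := by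
    simp [E, mul_comm]
  rw [this, Complex.norm_exp_ofReal_mul_I]

lemma E_conj (k : Fin d → ℤ) (x : Fin d → ℝ) : (starRingEnd ℂ) (E k x) = E (-k) x := by
  simp [E, ← Complex.exp_conj]

lemma E_cont (k : Fin d → ℤ) : Continuous (E k : (Fin d → ℝ) → ℂ) := by
  unfold E; fun_prop

lemma S_cont (T : Finset (Fin d → ℤ)) : Continuous (S T : (Fin d → ℝ) → ℂ) := by
  unfold S
  exact continuous_finsetSum _ fun a _ => E_cont a

lemma S_bound (T : Finset (Fin d → ℤ)) (z : Fin d → ℝ) : ‖S T z‖ ≤ T.card := by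
  unfold S
  refine (norm_sum_le _ _).trans ?_
  simp [E_norm]

lemma S_conj (T : Finset (Fin d → ℤ)) (z : Fin d → ℝ) :
    (starRingEnd ℂ) (S T z) = S T (-z) := by
  simp [S, E_conj, E_neg_swap]

lemma S_norm_symm (T : Finset (Fin d → ℤ)) (x y : Fin d → ℝ) :
    ‖S T (x - y)‖ = ‖S T (y - x)‖ := by
  rw [← neg_sub y x, ← S_conj, Complex.norm_conj]

def Orth (m : ℤ) (Q : Measure (Fin d → ℝ)) : Prop :=
  ∀ k : Fin d → ℤ, (∀ i, |k i| ≤ 4 * m) → ∫ x, E k x ∂Q = if k = 0 then 1 else 0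

lemma int_bdd {X F : Type*} [TopologicalSpace X] [MeasurableSpace X] [OpensMeasurableSpace X]
    [SecondCountableTopology X]
    [NormedAddCommGroup F] [SecondCountableTopology F]
    (Q : Measure X) [IsFiniteMeasure Q] (g : X → F) (hg : Continuous g) (C : ℝ)
    (h : ∀ x, ‖g x‖ ≤ C) : Integrable g Q :=
  Integrable.of_bound hg.aestronglyMeasurable C (Filter.Eventually.of_forall h)

lemma mem_box {m : ℤ} {k : Fin d → ℤ} : k ∈ box d m ↔ ∀ i, |k i| ≤ m := by
  simp [box, abs_le]

lemma E_int (Q : Measure (Fin d → ℝ)) [IsFiniteMeasure Q] (k : Fin d → ℤ) :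
    Integrable (E k) Q := int_bdd Q _ (E_cont k) 1 fun x => (E_norm k x).le

lemma S_mean (m : ℤ) (Q : Measure (Fin d → ℝ)) [IsFiniteMeasure Q] (hQ : Orth m Q)
    (T : Finset (Fin d → ℤ)) (hT : ∀ a ∈ T, ∀ i, |a i| ≤ 2 * m) (x : Fin d → ℝ) :
    ∫ y, ‖S T (y - x)‖ ^ 2 ∂Q = T.card := by
  have h1 : ∀ y, ((‖S T (y - x)‖ ^ 2 : ℝ) : ℂ)
      = ∑ a ∈ T, ∑ b ∈ T, E (b - a) x * E (a - b) y := by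
    intro y
    push_cast
    rw [← Complex.mul_conj', S_conj]
    simp only [S, Finset.sum_mul_sum]
    refine Finset.sum_congr rfl fun a _ => Finset.sum_congr rfl fun b _ => ?_
    rw [E_neg_swap, E_sub_arg, E_sub_arg, sub_eq_add_neg, sub_eq_add_neg, E_add, E_add, neg_neg]
    ring
  have h2 : ((∫ y, ‖S T (y - x)‖ ^ 2 ∂Q : ℝ) : ℂ) = (T.card : ℂ) := by
    rw [← integral_complex_ofReal]
    simp only [h1]
    rw [integral_finsetSum _ fun a _ => integrable_finsetSum _ fun b _ =>
      (E_int Q _).const_mul _]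
    have : ∀ a ∈ T, ∫ y, ∑ b ∈ T, E (b - a) x * E (a - b) y ∂Q = 1 := by
      intro a ha
      rw [integral_finsetSum _ fun b _ => (E_int Q _).const_mul _]
      rw [Finset.sum_eq_single a]
      · rw [integral_const_mul, hQ (a - a)]
        · simp [E]
        · intro i
          have := hT a ha i
          have := abs_nonneg (a i)
          simp; omega
      · intro b hb hba
        rw [integral_const_mul, hQ (a - b), if_neg, mul_zero]
        · exact sub_ne_zero.2 hba.symm
        · intro i
          have h3 := hT a ha i
          have h4 := hT b hb i
          rw [abs_le] at *
          simp only [Pi.sub_apply]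
          omega
      · exact fun h => absurd ha h
    rw [Finset.sum_congr rfl this]
    simp
  exact_mod_cast h2

lemma repro (m : ℤ) (hm : 0 ≤ m) (Q : Measure (Fin d → ℝ)) [IsFiniteMeasure Q] (hQ : Orth m Q)
    (k : Fin d → ℤ) (hk : k ∈ box d m) (x : Fin d → ℝ) :
    ∫ y, E k y * (S (box d (2 * m)) (x - y) * S (box d m) (y - x)) ∂Q
      = (box d m).card * E k x := by
  have h1 : ∀ y, E k y * (S (box d (2 * m)) (x - y) * S (box d m) (y - x))
      = ∑ b ∈ box d m, ∑ a ∈ box d (2 * m), E (a - b) x * E (k - a + b) y := by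
    intro y
    simp only [S]
    rw [mul_comm (∑ a ∈ _, _), Finset.sum_mul_sum, Finset.mul_sum]
    refine Finset.sum_congr rfl fun b _ => ?_
    rw [Finset.mul_sum]
    refine Finset.sum_congr rfl fun a _ => ?_
    rw [E_sub_arg, E_sub_arg, sub_eq_add_neg, sub_eq_add_neg, E_add, E_add, E_add]
    ring
  simp only [h1]
  rw [integral_finsetSum _ fun a _ => integrable_finsetSum _ fun b _ =>
      (E_int Q _).const_mul _]
  have : ∀ b ∈ box d m, ∫ y, ∑ a ∈ box d (2 * m), E (a - b) x * E (k - a + b) y ∂Q = E k x := by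
    intro b hb
    rw [integral_finsetSum _ fun b _ => (E_int Q _).const_mul _]
    rw [mem_box] at hb hk
    rw [Finset.sum_eq_single (k + b)]
    · rw [integral_const_mul, hQ]
      · simp
      · intro i; simp; omega
    · intro a ha hab
      rw [mem_box] at ha
      rw [integral_const_mul, hQ, if_neg, mul_zero]
      · intro h; apply hab
        rw [← sub_eq_zero, ← neg_eq_zero, ← h]; abel
      · intro i
        have h3 := ha i
        have h4 := hb i
        have h5 := hk i
        rw [abs_le] at *
        simp only [Pi.sub_apply, Pi.add_apply]
        omega
    · intro h
      exfalso; apply h; rw [mem_box]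
      intro i
      have h4 := hb i
      have h5 := hk i
      rw [abs_le] at *
      simp only [Pi.add_apply]
      omega
  rw [Finset.sum_congr rfl this]
  simp

def W (m : ℤ) (x y : Fin d → ℝ) : ℝ :=
  (‖S (box d (2 * m)) (y - x)‖ ^ 2 + ‖S (box d m) (y - x)‖ ^ 2) / (2 * (box d m).card)

lemma W_eq (m : ℤ) (x y : Fin d → ℝ) : W m x y =
  (‖S (box d (2 * m)) (y - x)‖ ^ 2 + ‖S (box d m) (y - x)‖ ^ 2) / (2 * (box d m).card) := rfl

def A (d : ℕ) (m : ℤ) : ℝ := ((box d (2 * m)).card + (box d m).card) / (2 * (box d m).card)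

lemma W_symm (m : ℤ) (x y : Fin d → ℝ) : W m x y = W m y x := by
  unfold W
  rw [S_norm_symm, S_norm_symm (box d m)]

lemma W_nonneg (m : ℤ) (x y : Fin d → ℝ) : 0 ≤ W m x y := by
  unfold W; positivity

lemma W_cont (m : ℤ) : Continuous (fun q : (Fin d → ℝ) × (Fin d → ℝ) => W m q.1 q.2) := by
  unfold W
  have := S_cont (box d (2 * m))
  have := S_cont (box d m)
  fun_prop

lemma W_bound (m : ℤ) : ∃ C : ℝ, 0 ≤ C ∧ ∀ x y : Fin d → ℝ, W m x y ≤ C := by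
  refine ⟨(((box d (2 * m)).card : ℝ) ^ 2 + ((box d m).card : ℝ) ^ 2) / (2 * (box d m).card),
    by positivity, fun x y => ?_⟩
  unfold W
  gcongr <;> exact S_bound _ _

lemma card_pos {m : ℤ} (hm : 0 ≤ m) : (0 : ℝ) < (box d m).card := by
  have : (0 : Fin d → ℤ) ∈ box d m := by rw [mem_box]; exact fun i => by simpa using hm
  exact_mod_cast Finset.card_pos.2 ⟨_, this⟩

lemma A_pos {m : ℤ} (hm : 0 ≤ m) : 0 < A d m := by
  have := card_pos (d := d) hm
  unfold A; positivity

lemma A_le {m : ℤ} (hm : 0 ≤ m) : A d m ≤ 2 ^ d := by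
  have h := card_pos (d := d) hm
  unfold A
  rw [div_le_iff₀ (by positivity)]
  have h1 : ((box d (2 * m)).card : ℝ) ≤ 2 ^ d * (box d m).card := by
    have : (box d (2 * m)).card ≤ 2 ^ d * (box d m).card := by
      simp only [box, Fintype.card_piFinset, Int.card_Icc, Finset.prod_const, Finset.card_univ,
        Fintype.card_fin]
      rw [← mul_pow]
      apply Nat.pow_le_pow_left
      omega
    exact_mod_cast this
  have h2 : (1 : ℝ) ≤ 2 ^ d := one_le_pow₀ (by norm_num)
  nlinarith

lemma W_mean (m : ℤ) (hm : 0 ≤ m) (Q : Measure (Fin d → ℝ)) [IsFiniteMeasure Q] (hQ : Orth m Q)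
    (x : Fin d → ℝ) : ∫ y, W m x y ∂Q = A d m := by
  unfold W A
  have hi : ∀ T : Finset (Fin d → ℤ), Integrable (fun y => ‖S T (y - x)‖ ^ 2) Q := by
    intro T
    have := S_cont T
    refine int_bdd Q _ (by fun_prop) ((T.card : ℝ) ^ 2) fun y => ?_
    rw [norm_pow, norm_norm]
    gcongr
    exact S_bound _ _
  rw [integral_div, integral_add (hi _) (hi _), S_mean m Q hQ, S_mean m Q hQ]
  · intro a ha i
    rw [mem_box] at ha
    have := ha i
    omega
  · intro a ha i
    rw [mem_box] at ha
    exact ha i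

attribute [irreducible] W A

lemma poly_cont {n : ℕ} {f : (Fin d → ℝ) → ℝ} (hf : IsRealTrigPolyCube d n f) :
    Continuous f ∧ ∃ C : ℝ, 0 ≤ C ∧ ∀ x, |f x| ≤ C := by
  obtain ⟨c, hc⟩ := hf
  constructor
  · have : f = fun x => (∑ k ∈ box d (2 ^ n), c k * E k x).re := by
      funext x
      rw [← Complex.ofReal_re (f x), hc x]; rfl
    rw [this]
    exact Complex.continuous_re.comp
      (continuous_finsetSum _ fun k _ => continuous_const.mul (E_cont k))
  · refine ⟨∑ k ∈ box d (2 ^ n), ‖c k‖, Finset.sum_nonneg fun _ _ => norm_nonneg _, fun x => ?_⟩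
    rw [← Real.norm_eq_abs, ← Complex.norm_real, hc x]
    refine (norm_sum_le _ _).trans (le_of_eq ?_)
    refine Finset.sum_congr rfl fun k _ => ?_
    rw [norm_mul]
    have := E_norm k x
    unfold E at this
    rw [this, mul_one]

lemma poly_le {n : ℕ} {f : (Fin d → ℝ) → ℝ} (hf : IsRealTrigPolyCube d n f)
    (Q : Measure (Fin d → ℝ)) [IsFiniteMeasure Q] (hQ : Orth (2 ^ n) Q) (x : Fin d → ℝ) :
    |f x| ≤ ∫ y, |f y| * W (2 ^ n) x y ∂Q := by
  obtain ⟨hcont, C, hC0, hC⟩ := poly_cont hf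
  obtain ⟨c, hc⟩ := hf
  set m : ℤ := 2 ^ n with hm
  have hm0 : 0 ≤ m := by positivity
  have hpos := card_pos (d := d) hm0
  have cA := S_cont (box d (2 * m))
  have cB := S_cont (box d m)
  have hc' : ∀ x, (f x : ℂ) = ∑ k ∈ box d m, c k * E k x := hc
  have hrep : ∫ y, (f y : ℂ) * (S (box d (2 * m)) (x - y) * S (box d m) (y - x)) ∂Q
      = (box d m).card * f x := by
    simp only [hc', Finset.sum_mul, Finset.mul_sum, mul_assoc]
    rw [integral_finsetSum]
    · refine Finset.sum_congr rfl fun k hk => ?_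
      rw [integral_const_mul, repro m hm0 Q hQ k hk x]
      ring
    · intro k _
      refine Integrable.const_mul ?_ _
      have := E_cont k
      refine int_bdd Q _ (by fun_prop) (1 * ((box d (2 * m)).card * (box d m).card)) fun y => ?_
      rw [norm_mul, norm_mul, E_norm]
      gcongr <;> exact S_bound _ _
  have h1 : (box d m).card * |f x| ≤ ∫ y, (box d m).card * (|f y| * W m x y) ∂Q := by
    calc (box d m).card * |f x| = ‖((box d m).card * f x : ℂ)‖ := by simp
      _ ≤ ∫ y, ‖(f y : ℂ) * (S (box d (2 * m)) (x - y) * S (box d m) (y - x))‖ ∂Q := by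
        rw [← hrep]; exact norm_integral_le_integral_norm _
      _ ≤ _ := by
        obtain ⟨CW, hCW0, hCW⟩ := W_bound (d := d) m
        have cW := W_cont (d := d) m
        refine integral_mono ?_ ?_ ?_
        · refine int_bdd Q _ (by fun_prop) (C * ((box d (2 * m)).card * (box d m).card)) fun y => ?_
          rw [norm_norm, norm_mul, norm_mul]
          gcongr
          · simpa using hC y
          · exact S_bound _ _
          · exact S_bound _ _
        · refine Integrable.const_mul ?_ _
          have : Continuous fun y => W m x y := cW.comp (Continuous.prodMk_right x)
          refine int_bdd Q _ (hcont.abs.mul this) (C * CW) fun y => ?_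
          rw [norm_mul, Real.norm_eq_abs, Real.norm_eq_abs, abs_abs, abs_of_nonneg (W_nonneg m x y)]
          exact mul_le_mul (hC y) (hCW x y) (W_nonneg m x y) hC0
        · intro y
          simp only [norm_mul, Complex.norm_real, Real.norm_eq_abs]
          rw [S_norm_symm]
          have : (box d m).card * W m x y
              = (‖S (box d (2 * m)) (y - x)‖ ^ 2 + ‖S (box d m) (y - x)‖ ^ 2) / 2 := by
            rw [W_eq]; field_simp
          rw [mul_left_comm ((box d m).card : ℝ), this]
          gcongr
          nlinarith [sq_nonneg (‖S (box d (2 * m)) (y - x)‖ - ‖S (box d m) (y - x)‖)]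
  rw [integral_const_mul] at h1
  exact le_of_mul_le_mul_left h1 hpos

lemma tangent {p t a : ℝ} (hp : 1 ≤ p) (ht : 0 ≤ t) (ha : 0 < a) :
    a ^ p + p * a ^ (p - 1) * (t - a) ≤ t ^ p := by
  have h := one_add_mul_self_le_rpow_one_add (s := t / a - 1) (by
    have : 0 ≤ t / a := by positivity
    linarith) hp
  rw [add_sub_cancel, Real.div_rpow ht ha.le, le_div_iff₀ (by positivity)] at h
  rw [Real.rpow_sub_one ha.ne']
  refine le_trans (le_of_eq ?_) h
  field_simp

lemma main {n : ℕ} {f : (Fin d → ℝ) → ℝ} (hf : IsRealTrigPolyCube d n f)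
    (P Q : Measure (Fin d → ℝ)) [IsFiniteMeasure P] [IsFiniteMeasure Q]
    (hP : Orth (2 ^ n) P) (hQ : Orth (2 ^ n) Q) {p : ℝ} (hp : 1 ≤ p) :
    (∫ x, |f x| ^ p ∂P) ^ (1 / p) ≤ 2 ^ d * (∫ x, |f x| ^ p ∂Q) ^ (1 / p) := by
  have hp0 : 0 < p := by linarith
  obtain ⟨hcont, C, hC0, hC⟩ := poly_cont hf
  have hle := poly_le hf Q hQ
  have hWm := W_mean (d := d) (2 ^ n) (by positivity) Q hQ
  have hWm' := W_mean (d := d) (2 ^ n) (by positivity) P hP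
  have hA := A_pos (d := d) (m := 2 ^ n) (by positivity)
  have hA2 := A_le (d := d) (m := 2 ^ n) (by positivity)
  generalize (2 ^ n : ℤ) = m at *
  obtain ⟨CW, hCW0, hCW⟩ := W_bound (d := d) m
  have cW := W_cont (d := d) m
  have cWx : ∀ x, Continuous fun y => W m x y := fun x => cW.comp (Continuous.prodMk_right x)
  have cfp : Continuous fun y => |f y| ^ p := hcont.abs.rpow_const fun _ => Or.inr hp0.le
  have bfp : ∀ y, |f y| ^ p ≤ C ^ p := fun y => Real.rpow_le_rpow (abs_nonneg _) (hC y) hp0.le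
  have nn : ∀ y, 0 ≤ |f y| ^ p := fun y => by positivity
  have i1 : ∀ x, Integrable (fun y => |f y| * W m x y) Q := by
    intro x
    refine int_bdd Q _ (hcont.abs.mul (cWx x)) (C * CW) fun y => ?_
    rw [norm_mul, Real.norm_eq_abs, Real.norm_eq_abs, abs_abs, abs_of_nonneg (W_nonneg m x y)]
    exact mul_le_mul (hC y) (hCW x y) (W_nonneg m x y) hC0
  have i0 : ∀ x, Integrable (fun y => W m x y) Q := by
    intro x
    refine int_bdd Q _ (cWx x) CW fun y => ?_
    rw [Real.norm_eq_abs, abs_of_nonneg (W_nonneg m x y)]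
    exact hCW x y
  have ip : ∀ x, Integrable (fun y => |f y| ^ p * W m x y) Q := by
    intro x
    refine int_bdd Q _ (cfp.mul (cWx x)) (C ^ p * CW) fun y => ?_
    rw [norm_mul, Real.norm_eq_abs, Real.norm_eq_abs, abs_of_nonneg (nn y),
      abs_of_nonneg (W_nonneg m x y)]
    exact mul_le_mul (bfp y) (hCW x y) (W_nonneg m x y) (by positivity)
  have iprod : Integrable (fun q : (Fin d → ℝ) × (Fin d → ℝ) => |f q.2| ^ p * W m q.1 q.2)
      (P.prod Q) := by
    refine int_bdd (P.prod Q) _ ((cfp.comp continuous_snd).mul cW) (C ^ p * CW) fun q => ?_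
    rw [norm_mul, Real.norm_eq_abs, Real.norm_eq_abs, abs_of_nonneg (nn q.2),
      abs_of_nonneg (W_nonneg m q.1 q.2)]
    exact mul_le_mul (bfp q.2) (hCW q.1 q.2) (W_nonneg m q.1 q.2) (by positivity)
  -- pointwise Jensen
  have jensen : ∀ x, |f x| ^ p ≤ A d m ^ (p - 1) * ∫ y, |f y| ^ p * W m x y ∂Q := by
    intro x
    have hRnn : 0 ≤ ∫ y, |f y| ^ p * W m x y ∂Q :=
      integral_nonneg fun y => mul_nonneg (nn y) (W_nonneg m x y)
    rcases eq_or_lt_of_le (abs_nonneg (f x)) with h0 | h0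
    · rw [← h0, Real.zero_rpow hp0.ne']
      positivity
    set a := |f x| / A d m with ha
    have ha0 : 0 < a := by positivity
    have hfa : |f x| = a * A d m := by rw [ha]; field_simp
    have h1 : ∫ y, (a ^ p * W m x y + p * a ^ (p - 1) * (|f y| * W m x y - a * W m x y)) ∂Q
        ≤ ∫ y, |f y| ^ p * W m x y ∂Q := by
      refine integral_mono (((i0 x).const_mul _).add
        (((i1 x).sub ((i0 x).const_mul _)).const_mul _)) (ip x) fun y => ?_
      have := mul_le_mul_of_nonneg_right (tangent hp (abs_nonneg (f y)) ha0) (W_nonneg m x y)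
      refine le_trans (le_of_eq ?_) this
      ring
    have i2 : Integrable (fun y => p * a ^ (p - 1) * (|f y| * W m x y - a * W m x y)) Q :=
      ((i1 x).sub ((i0 x).const_mul _)).const_mul _
    rw [integral_add ((i0 x).const_mul _) i2,
      integral_const_mul, integral_const_mul, integral_sub (i1 x) ((i0 x).const_mul _),
      integral_const_mul, hWm x] at h1
    have h2 : 0 ≤ p * a ^ (p - 1) * (∫ y, |f y| * W m x y ∂Q - a * A d m) := by
      have := hle x
      rw [hfa] at this
      have h3 : 0 ≤ ∫ y, |f y| * W m x y ∂Q - a * A d m := by linarith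
      positivity
    calc |f x| ^ p = A d m ^ (p - 1) * (a ^ p * A d m) := by
          rw [hfa, Real.mul_rpow ha0.le hA.le, Real.rpow_sub_one hA.ne']
          field_simp
      _ ≤ _ := by
          gcongr
          linarith
  have key : ∫ x, |f x| ^ p ∂P ≤ A d m ^ p * ∫ x, |f x| ^ p ∂Q := by
    calc ∫ x, |f x| ^ p ∂P
        ≤ ∫ x, A d m ^ (p - 1) * ∫ y, |f y| ^ p * W m x y ∂Q ∂P := by
          refine integral_mono (int_bdd P _ cfp (C ^ p) fun y => ?_)
            (iprod.integral_prod_left.const_mul _) jensen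
          rw [Real.norm_eq_abs, abs_of_nonneg (nn y)]
          exact bfp y
      _ = A d m ^ (p - 1) * ∫ y, ∫ x, |f y| ^ p * W m x y ∂P ∂Q := by
          rw [integral_const_mul, integral_integral_swap iprod]
      _ = A d m ^ (p - 1) * ∫ y, |f y| ^ p * A d m ∂Q := by
          congr 2
          funext y
          rw [integral_const_mul]
          congr 1
          rw [← hWm' y]
          exact integral_congr_ae (Filter.Eventually.of_forall fun x => W_symm m x y)
      _ = _ := by
          rw [integral_mul_const, Real.rpow_sub_one hA.ne']
          field_simp
  have nQ : 0 ≤ ∫ x, |f x| ^ p ∂Q := integral_nonneg nn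
  calc (∫ x, |f x| ^ p ∂P) ^ (1 / p) ≤ (A d m ^ p * ∫ x, |f x| ^ p ∂Q) ^ (1 / p) :=
        Real.rpow_le_rpow (integral_nonneg nn) key (by positivity)
    _ = A d m * (∫ x, |f x| ^ p ∂Q) ^ (1 / p) := by
        rw [Real.mul_rpow (by positivity) nQ, ← Real.rpow_mul hA.le, mul_one_div_cancel hp0.ne',
          Real.rpow_one]
    _ ≤ _ := by gcongr

lemma main_sup {n : ℕ} {f : (Fin d → ℝ) → ℝ} (hf : IsRealTrigPolyCube d n f)
    (Q : Measure (Fin d → ℝ)) [IsFiniteMeasure Q] (hQ : Orth (2 ^ n) Q) {B : ℝ} (hB : 0 ≤ B)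
    (h : ∀ᵐ y ∂Q, |f y| ≤ B) (x : Fin d → ℝ) : |f x| ≤ 2 ^ d * B := by
  obtain ⟨hcont, C, hC0, hC⟩ := poly_cont hf
  have hle := poly_le hf Q hQ x
  have hWm := W_mean (d := d) (2 ^ n) (by positivity) Q hQ x
  have hA2 := A_le (d := d) (m := 2 ^ n) (by positivity)
  generalize (2 ^ n : ℤ) = m at *
  obtain ⟨CW, hCW0, hCW⟩ := W_bound (d := d) m
  have cW := W_cont (d := d) m
  have cWx : Continuous fun y => W m x y := cW.comp (Continuous.prodMk_right x)
  calc |f x| ≤ _ := hle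
    _ ≤ ∫ y, B * W m x y ∂Q := by
      refine integral_mono_ae ?_ ?_ ?_
      · refine int_bdd Q _ (hcont.abs.mul cWx) (C * CW) fun y => ?_
        rw [norm_mul, Real.norm_eq_abs, Real.norm_eq_abs, abs_abs, abs_of_nonneg (W_nonneg m x y)]
        exact mul_le_mul (hC y) (hCW x y) (W_nonneg m x y) hC0
      · refine Integrable.const_mul (int_bdd Q _ cWx CW fun y => ?_) _
        rw [Real.norm_eq_abs, abs_of_nonneg (W_nonneg m x y)]
        exact hCW x y
      · filter_upwards [h] with y hy
        exact mul_le_mul_of_nonneg_right hy (W_nonneg m x y)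
    _ = A d m * B := by rw [integral_const_mul, hWm, mul_comm]
    _ ≤ _ := by gcongr

lemma E_prod (k : Fin d → ℤ) (x : Fin d → ℝ) :
    E k x = ∏ j, Complex.exp (Complex.I * ((k j : ℂ) * (x j : ℂ))) := by
  rw [E, Finset.mul_sum, Complex.exp_sum]

lemma int_one (k : ℤ) : ∫ x in Set.Ico 0 (2 * Real.pi), Complex.exp (Complex.I * ((k : ℂ) * (x : ℂ)))
    = if k = 0 then (2 * Real.pi : ℂ) else 0 := by
  rw [integral_Ico_eq_integral_Ioc, ← intervalIntegral.integral_of_le (by positivity)]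
  split_ifs with h
  · simp [h]
  · have hk : (Complex.I * k : ℂ) ≠ 0 := by simp [h]
    simp only [← mul_assoc]
    rw [integral_exp_mul_complex hk]
    have : (Complex.I * k * ((2 * Real.pi : ℝ) : ℂ)) = k * (2 * Real.pi * Complex.I) := by
      push_cast; ring
    rw [this, Complex.exp_int_mul_two_pi_mul_I]
    simp

lemma orth_torus (m : ℤ) : Orth m (torusMeasure d) := by
  intro k _
  unfold torusMeasure torusCell
  rw [integral_smul_measure, volume_pi, Measure.restrict_pi_pi]
  simp only [E_prod]
  rw [integral_fintype_prod_eq_prod (𝕜 := ℂ)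
    (fun j (t : ℝ) => Complex.exp (Complex.I * ((k j : ℂ) * (t : ℂ))))]
  simp only [int_one]
  have hpi : (0 : ℝ) < (2 * Real.pi) ^ d := by positivity
  split_ifs with h
  · subst h
    simp [ENNReal.toReal_inv, ENNReal.toReal_ofReal, Real.pi_pos.le]
  · obtain ⟨i, hi⟩ := Function.ne_iff.1 h
    rw [Finset.prod_eq_zero (Finset.mem_univ i), smul_zero]
    simpa using hi

instance : IsFiniteMeasure (torusMeasure d) := by
  have : IsFiniteMeasure (volume.restrict (torusCell d)) := by
    constructor
    rw [Measure.restrict_apply_univ, torusCell, volume_pi, Measure.pi_pi]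
    exact ENNReal.prod_lt_top fun i _ => by
      rw [Real.volume_Ico]; exact ENNReal.ofReal_lt_top
  unfold torusMeasure
  refine Measure.smul_finite _ ?_
  simp
  positivity

def pt (M : ℕ) (j : Fin d → Fin M) : Fin d → ℝ := fun i => 2 * Real.pi * (j i : ℕ) / M

def disc {ι : Type*} [Fintype ι] (Y : ι → Fin d → ℝ) : Measure (Fin d → ℝ) :=
  (ENNReal.ofReal (1 / Fintype.card ι)) • ∑ j, Measure.dirac (Y j)

lemma disc_int {ι : Type*} [Fintype ι] {F : Type*} [NormedAddCommGroup F] [NormedSpace ℝ F]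
    [CompleteSpace F]
    (Y : ι → Fin d → ℝ) (g : (Fin d → ℝ) → F) :
    ∫ x, g x ∂(disc Y) = (1 / Fintype.card ι : ℝ) • ∑ j, g (Y j) := by
  unfold disc
  rw [integral_smul_measure, integral_finsetSum_measure]
  · simp only [integral_dirac]
    rw [ENNReal.toReal_ofReal (by positivity)]
  · intro i _
    exact integrable_dirac (by simp)

instance {ι : Type*} [Fintype ι] (Y : ι → Fin d → ℝ) : IsFiniteMeasure (disc Y) := by
  unfold disc
  exact Measure.smul_finite _ (by simp)

lemma sum_one (M : ℕ) (hM : 0 < M) (k : ℤ) (hk : |k| < M) :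
    ∑ j : Fin M, Complex.exp (Complex.I * ((k : ℂ) * ((2 * Real.pi * (j : ℕ) / M : ℝ) : ℂ)))
      = if k = 0 then (M : ℂ) else 0 := by
  split_ifs with h
  · simp [h]
  have hM' : (M : ℂ) ≠ 0 := by exact_mod_cast hM.ne'
  set z := Complex.exp (2 * Real.pi * Complex.I * (k / M)) with hz
  have h1 : ∀ j : Fin M, Complex.exp (Complex.I * ((k : ℂ) * ((2 * Real.pi * (j : ℕ) / M : ℝ) : ℂ)))
      = z ^ (j : ℕ) := by
    intro j
    rw [hz, ← Complex.exp_nat_mul]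
    congr 1
    push_cast
    ring
  simp only [h1]
  rw [Fin.sum_univ_eq_sum_range (fun j => z ^ j) M]
  have hz1 : z ≠ 1 := by
    intro hz1
    rw [hz, Complex.exp_eq_one_iff] at hz1
    obtain ⟨r, hr⟩ := hz1
    have hpi : (2 * Real.pi * Complex.I : ℂ) ≠ 0 := Complex.two_pi_I_ne_zero
    rw [mul_comm (r : ℂ)] at hr
    have h2 := mul_left_cancel₀ hpi hr
    rw [div_eq_iff hM'] at h2
    have h3 : k = r * M := by exact_mod_cast h2
    exact h (Int.eq_zero_of_abs_lt_dvd ⟨r, by rw [h3, mul_comm]⟩ hk)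
  have hzM : z ^ M = 1 := by
    rw [hz, ← Complex.exp_nat_mul, Complex.exp_eq_one_iff]
    exact ⟨k, by field_simp⟩
  rw [geom_sum_eq hz1, hzM]
  simp

lemma orth_disc (m : ℤ) (hm : 0 ≤ m) (M : ℕ) (hM : 4 * m < M) {ι : Type*} [Fintype ι]
    (e : ι ≃ (Fin d → Fin M)) : Orth m (disc fun j => pt M (e j)) := by
  intro k hk
  have hM0 : 0 < M := by omega
  have hM' : (M : ℂ) ≠ 0 := by exact_mod_cast hM0.ne'
  rw [disc_int, Fintype.card_congr e, e.sum_comp (fun j => E k (pt M j))]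
  simp only [E_prod, pt]
  rw [← Fintype.prod_sum (fun (i : Fin d) (j : Fin M) =>
    Complex.exp (Complex.I * ((k i : ℂ) * ((2 * Real.pi * (j : ℕ) / M : ℝ) : ℂ))))]
  have h1 : ∀ i, ∑ j : Fin M,
      Complex.exp (Complex.I * ((k i : ℂ) * ((2 * Real.pi * (j : ℕ) / M : ℝ) : ℂ)))
      = if k i = 0 then (M : ℂ) else 0 := fun i => sum_one M hM0 (k i) (lt_of_le_of_lt (hk i) hM)
  simp only [h1]
  split_ifs with h
  · subst h
    simp [hM']
  · obtain ⟨i, hi⟩ := Function.ne_iff.1 h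
    rw [Finset.prod_eq_zero (Finset.mem_univ i), smul_zero]
    exact if_neg hi

end MZ

/-- For each `d` there are constants `C1(d), C2(d), C3(d) > 0` such that for
every `n` there is a set of `s ≤ C1(d) 2^{nd}` points of the torus discretizing all `L_p` norms,
`1 ≤ p ≤ ∞`, of real trigonometric polynomials with frequencies in `Π_n = [-2^n, 2^n]^d`. -/
theorem stmt_14 (d : ℕ) :
    ∃ C1 C2 C3 : ℝ, 0 < C1 ∧ 0 < C2 ∧ 0 < C3 ∧
      ∀ n : ℕ, ∃ (s : ℕ) (Y : Fin s → (Fin d → ℝ)),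
        (s : ℝ) ≤ C1 * 2 ^ (n * d) ∧ (∀ j, Y j ∈ torusCell d) ∧
        ∀ f : (Fin d → ℝ) → ℝ, IsRealTrigPolyCube d n f →
          (∀ p : ℝ, 1 ≤ p →
            C2 * torusLq d p f ≤ ((1 / s : ℝ) * ∑ j, |f (Y j)| ^ p) ^ (1 / p) ∧
            ((1 / s : ℝ) * ∑ j, |f (Y j)| ^ p) ^ (1 / p) ≤ C3 * torusLq d p f) ∧
          (C2 * torusSup d f ≤ (⨆ j : Fin s, |f (Y j)|) ∧
            (⨆ j : Fin s, |f (Y j)|) ≤ C3 * torusSup d f) := by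
  refine ⟨8 ^ d, (2 ^ d)⁻¹, 2 ^ d, by positivity, by positivity, by positivity, fun n => ?_⟩
  set M : ℕ := 8 * 2 ^ n with hMdef
  have hM0 : 0 < M := by positivity
  have hM : 4 * (2 ^ n : ℤ) < M := by
    have : (0 : ℤ) < 2 ^ n := by positivity
    rw [hMdef]; push_cast; omega
  have hcard : Fintype.card (Fin d → Fin M) = M ^ d := by simp
  let e : Fin (M ^ d) ≃ (Fin d → Fin M) := (Fintype.equivFinOfCardEq hcard).symm
  have hY := MZ.orth_disc (2 ^ n) (by positivity) M hM e
  have hmem : ∀ j, MZ.pt M (e j) ∈ torusCell d := by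
    intro j i _
    have hpi := Real.pi_pos
    have hMr : (0 : ℝ) < M := by exact_mod_cast hM0
    have hlt : ((e j i : ℕ) : ℝ) < M := by exact_mod_cast (e j i).2
    refine ⟨by unfold MZ.pt; positivity, ?_⟩
    unfold MZ.pt
    rw [div_lt_iff₀ hMr]
    gcongr
  refine ⟨M ^ d, fun j => MZ.pt M (e j), ?_, hmem, fun f hf => ⟨fun p hp => ?_, ?_, ?_⟩⟩
  · rw [hMdef]; push_cast
    rw [mul_pow, pow_mul]
  · have h1 := MZ.main hf (torusMeasure d) _ (MZ.orth_torus _) hY hp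
    have h2 := MZ.main hf _ (torusMeasure d) hY (MZ.orth_torus _) hp
    rw [MZ.disc_int, smul_eq_mul, Fintype.card_fin] at h1 h2
    unfold torusLq
    simp only [Real.norm_eq_abs]
    refine ⟨?_, h2⟩
    rw [inv_mul_le_iff₀ (by positivity)]
    exact h1
  · have hb : BddAbove (Set.range fun j : Fin (M ^ d) => |f (MZ.pt M (e j))|) :=
      (Set.finite_range _).bddAbove
    rw [inv_mul_le_iff₀ (by positivity)]
    have hnn : 0 ≤ ⨆ j : Fin (M ^ d), |f (MZ.pt M (e j))| := Real.iSup_nonneg fun _ => abs_nonneg _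
    refine Real.iSup_le (fun x => ?_) (by positivity)
    refine MZ.main_sup hf _ hY hnn ?_ x
    unfold MZ.disc
    refine Measure.ae_smul_measure ?_ _
    rw [← Measure.sum_fintype, Measure.ae_sum_iff]
    intro j
    obtain ⟨hc, -⟩ := MZ.poly_cont hf
    rw [ae_dirac_eq]
    exact le_ciSup hb j
  · obtain ⟨-, C, hC0, hC⟩ := MZ.poly_cont hf
    have hb : BddAbove (Set.range fun x : torusCell d => |f x.1|) := by
      refine ⟨C, ?_⟩
      rintro _ ⟨x, rfl⟩
      exact hC _
    have hnn : 0 ≤ torusSup d f := Real.iSup_nonneg fun _ => abs_nonneg _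
    refine Real.iSup_le (fun j => ?_) (by positivity)
    have h1 : |f (MZ.pt M (e j))| ≤ torusSup d f := le_ciSup hb ⟨_, hmem j⟩
    have h2 : (1 : ℝ) ≤ 2 ^ d := one_le_pow₀ (by norm_num)
    nlinarith
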